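/- Let d ≥ 1 and suppose D decays super-exponentially: for every a > 0, D(x)e^{a‖x‖₂} → 0 as ‖x‖₂ → ∞. Then for every z ∈ (0,1), S_z satisfies Assumptions Ω and J with h = δ₀ (the point mass at 0) and J = zD. Moreover, for any ε ∈ (0,1) and any ζ > 0, there exist constants M, K > 0 such that ((zD)^{(μ)}, δ₀) ∈ 𝒬_{M,K,ζ} for all z ∈ [ε, 1) and all μ ∈ Ω̄_z, where Ω_z denotes the set Ω associated with S_z. -/

import Mathlib

open scoped BigOperators ENNReal Real Topology Pointwise
open MeasureTheory Matrix Filter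

noncomputable section

namespace OZpaper

variable {d : ℕ}

/-- Dot product of a real vector with a lattice point. -/
def rdotZ (μ : Fin d → ℝ) (x : Fin d → ℤ) : ℝ := ∑ i, μ i * (x i : ℝ)

/-- Dot product of two real vectors. -/
def rdot (μ x : Fin d → ℝ) : ℝ := ∑ i, μ i * x i

/-- Euclidean norm of a lattice point. -/
def enormZ (x : Fin d → ℤ) : ℝ := Real.sqrt (∑ i, ((x i : ℝ)) ^ 2)

/-- Euclidean norm of a real vector. -/
def enormR (x : Fin d → ℝ) : ℝ := Real.sqrt (∑ i, (x i) ^ 2)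

/-- ℓ¹ norm of a real vector. -/
def l1R (x : Fin d → ℝ) : ℝ := ∑ i, |x i|

/-- ℓ∞ norm of a real vector. -/
def linftyR (x : Fin d → ℝ) : ℝ := ⨆ i, |x i|

/-- The vector `t • e₁`. -/
def e1R (d : ℕ) (t : ℝ) : Fin d → ℝ := fun i => if (i : ℕ) = 0 then t else 0

/-- The lattice point `n • e₁`. -/
def e1Z (d : ℕ) (n : ℤ) : Fin d → ℤ := fun i => if (i : ℕ) = 0 then n else 0

/-- Cast of a lattice point to a real vector. -/
def toR (x : Fin d → ℤ) : Fin d → ℝ := fun i => (x i : ℝ)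

/-- ℤ^d-symmetry: invariance under coordinate permutations and sign flips. -/
def ZdSymmetric (f : (Fin d → ℤ) → ℝ) : Prop :=
  (∀ (σ : Equiv.Perm (Fin d)) (x : Fin d → ℤ), f (fun i => x (σ i)) = f x) ∧
  (∀ (ε : Fin d → Bool) (x : Fin d → ℤ), f (fun i => if ε i then -(x i) else x i) = f x)

/-- Tilted susceptibility `χ^{(μ)}`, valued in `ℝ≥0∞`. -/
def chi (S : (Fin d → ℤ) → ℝ) (μ : Fin d → ℝ) : ℝ≥0∞ :=
  ∑' x, ENNReal.ofReal (S x * Real.exp (rdotZ μ x))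

/-- The set `Ω = {μ : χ^{(μ)} < ∞}`. -/
def Omega (S : (Fin d → ℤ) → ℝ) : Set (Fin d → ℝ) := {μ | chi S μ < ⊤}

/-- The mass `m_S`. -/
def mass (S : (Fin d → ℤ) → ℝ) : ℝ := sSup {t : ℝ | 0 ≤ t ∧ chi S (e1R d t) < ⊤}

/-- Assumption Ω. -/
structure AssumptionOmega (S : (Fin d → ℤ) → ℝ) : Prop where
  nonneg : ∀ x, 0 ≤ S x
  symm : ZdSymmetric S
  open_Omega : IsOpen (Omega S)
  zero_mem : (0 : Fin d → ℝ) ∈ Omega S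
  exists_not_mem : ∃ μ₁ : ℝ, 0 < μ₁ ∧ e1R d μ₁ ∉ Omega S

/-- Fourier transform `Q̂(k) = ∑_y Q(y) e^{-i k·y}`. -/
def fourierZ (Q : (Fin d → ℤ) → ℝ) (k : Fin d → ℝ) : ℂ :=
  ∑' y, (Q y : ℂ) * Complex.exp (-Complex.I * (rdotZ k y : ℂ))

/-- ℓ^p norm of a function on ℤ^d, valued in `ℝ≥0∞`. -/
def lpNorm (f : (Fin d → ℤ) → ℝ) (p : ℝ) : ℝ≥0∞ :=
  (∑' y, ENNReal.ofReal (|f y| ^ p)) ^ (1 / p)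

/-- The exponent `p_d`. -/
def pExp (d : ℕ) (ζ : ℝ) : ℝ := if d = 1 then 2 else (d : ℝ) / ((d : ℝ) - 2 + min ζ 2)

/-- The class 𝒬_{M,K,ζ} without the (d-1)-th moment bounds. -/
structure MemQweak (M K ζ : ℝ) (Q g : (Fin d → ℤ) → ℝ) : Prop where
  Q_l1 : lpNorm Q 1 ≤ ENNReal.ofReal M
  Q_moment : lpNorm (fun y => enormZ y ^ (2 + ζ) * Q y) 1 ≤ ENNReal.ofReal M
  infrared : ∀ k : Fin d → ℝ, (∀ i, |k i| ≤ π) →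
    K * enormR k ^ 2 ≤ (fourierZ Q 0 - fourierZ Q k).re
  g_l1 : lpNorm g 1 ≤ ENNReal.ofReal M
  g_zeta : lpNorm (fun y => enormZ y ^ ζ * g y) 1 ≤ ENNReal.ofReal M
  g_two : lpNorm (fun y => enormZ y ^ (2 : ℝ) * g y) (min (pExp d ζ) 2) ≤ ENNReal.ofReal M

/-- The class 𝒬_{M,K,ζ}. -/
structure MemQ (M K ζ : ℝ) (Q g : (Fin d → ℤ) → ℝ) : Prop where
  Q_l1 : lpNorm Q 1 ≤ ENNReal.ofReal M
  Q_moment : lpNorm (fun y => enormZ y ^ (2 + ζ) * Q y) 1 ≤ ENNReal.ofReal M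
  infrared : ∀ k : Fin d → ℝ, (∀ i, |k i| ≤ π) →
    K * enormR k ^ 2 ≤ (fourierZ Q 0 - fourierZ Q k).re
  g_l1 : lpNorm g 1 ≤ ENNReal.ofReal M
  g_zeta : lpNorm (fun y => enormZ y ^ ζ * g y) 1 ≤ ENNReal.ofReal M
  g_two : lpNorm (fun y => enormZ y ^ (2 : ℝ) * g y) (min (pExp d ζ) 2) ≤ ENNReal.ofReal M
  Q_dm1 : 4 ≤ d →
    lpNorm (fun y => enormZ y ^ ((d : ℝ) - 1) * Q y) (min ((d : ℝ) / 3) 2) ≤ ENNReal.ofReal M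
  g_dm1 : 4 ≤ d →
    lpNorm (fun y => enormZ y ^ ((d : ℝ) - 1) * g y) 2 ≤ ENNReal.ofReal M

/-- Convolution on ℤ^d. -/
def conv (f g : (Fin d → ℤ) → ℝ) (x : Fin d → ℤ) : ℝ := ∑' y, f (x - y) * g y

/-- Exponential tilt `f^{(μ)}`. -/
def tilt (f : (Fin d → ℤ) → ℝ) (μ : Fin d → ℝ) : (Fin d → ℤ) → ℝ :=
  fun x => f x * Real.exp (rdotZ μ x)

/-- `∑_y f(y) e^{μ·y}`, i.e. `f̂^{(μ)}(0)`. -/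
def tiltSum (f : (Fin d → ℤ) → ℝ) (μ : Fin d → ℝ) : ℝ := ∑' y, f y * Real.exp (rdotZ μ y)

/-- Assumption J. -/
structure AssumptionJ (S J h : (Fin d → ℤ) → ℝ) (M K ζ : ℝ) : Prop where
  M_pos : 0 < M
  K_pos : 0 < K
  zeta_pos : 0 < ζ
  J_symm : ZdSymmetric J
  h_symm : ZdSymmetric h
  J_summable : Summable fun x => |J x|
  h_summable : Summable fun x => |h x|
  OZ_eq : ∀ x, S x = h x + conv J S x
  memQ : ∀ μ ∈ closure (Omega S), MemQ M K ζ (tilt J μ) (tilt h μ)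
  hhat_pos : ∀ μ ∈ closure (Omega S), 0 < tiltSum h μ

/-- Assumption J, without the (d-1)-th moment bounds of the class 𝒬. -/
structure AssumptionJweak (S J h : (Fin d → ℤ) → ℝ) (M K ζ : ℝ) : Prop where
  M_pos : 0 < M
  K_pos : 0 < K
  zeta_pos : 0 < ζ
  J_symm : ZdSymmetric J
  h_symm : ZdSymmetric h
  J_summable : Summable fun x => |J x|
  h_summable : Summable fun x => |h x|
  OZ_eq : ∀ x, S x = h x + conv J S x
  memQ : ∀ μ ∈ closure (Omega S), MemQweak M K ζ (tilt J μ) (tilt h μ)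
  hhat_pos : ∀ μ ∈ closure (Omega S), 0 < tiltSum h μ

/-- `μ` is the optimal tilt `μ_x̂` for direction `x`. -/
def IsOptTilt (S : (Fin d → ℤ) → ℝ) (x μ : Fin d → ℝ) : Prop :=
  μ ∈ frontier (Omega S) ∧ ∀ ν ∈ closure (Omega S), rdot ν x ≤ rdot μ x

/-- The norm `|x|_S = (max_{μ ∈ Ω̄} μ·x)/m_S`. -/
def normS (S : (Fin d → ℤ) → ℝ) (x : Fin d → ℝ) : ℝ :=
  sSup ((fun μ => rdot μ x) '' closure (Omega S)) / mass S

/-- The drift vector `η` of the tilted kernel. -/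
def etaOf (J : (Fin d → ℤ) → ℝ) (μ : Fin d → ℝ) : Fin d → ℝ :=
  fun j => ∑' y, (y j : ℝ) * J y * Real.exp (rdotZ μ y)

/-- The covariance matrix `Λ` of the tilted kernel. -/
def LambdaOf (J : (Fin d → ℤ) → ℝ) (μ : Fin d → ℝ) : Matrix (Fin d) (Fin d) ℝ :=
  Matrix.of fun j l => ∑' y, (y j : ℝ) * (y l : ℝ) * J y * Real.exp (rdotZ μ y)

/-- The Brownian heat kernel `ρ_t(x; η, Λ)`. -/
def heatKer (d : ℕ) (t : ℝ) (x η : Fin d → ℝ) (Λ : Matrix (Fin d) (Fin d) ℝ) : ℝ :=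
  (1 / Real.sqrt Λ.det) * (1 / (2 * π * t) ^ ((d : ℝ) / 2)) *
    Real.exp (-(1 / (2 * t)) * rdot (x - t • η) (Λ⁻¹ *ᵥ (x - t • η)))

/-- The Brownian Green function `𝒞(x; η, Λ)`. -/
def greenC (d : ℕ) (x η : Fin d → ℝ) (Λ : Matrix (Fin d) (Fin d) ℝ) : ℝ :=
  ∫ t in Set.Ioi (0 : ℝ), heatKer d t x η Λ

/-- The massive continuum Green function `𝔾_a(x)`. -/
def massiveG (d : ℕ) (a : ℝ) (x : Fin d → ℝ) : ℝ :=
  ∫ t in Set.Ioi (0 : ℝ),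
    (1 / (2 * π * t) ^ ((d : ℝ) / 2)) * Real.exp (-enormR x ^ 2 / (2 * t)) *
      Real.exp (-(t * a ^ 2) / 2)

/-- The constant `A_φ = ∫_{ℝ^d} ‖y‖₂^φ 𝔾₁(y) dy`. -/
def Aconst (d : ℕ) (φ : ℝ) : ℝ := ∫ y : Fin d → ℝ, enormR y ^ φ * massiveG d 1 y

/-- The torus `[-π, π]^d`. -/
def torus (d : ℕ) : Set (Fin d → ℝ) := Set.univ.pi fun _ => Set.Icc (-π) π

/-- The Fourier integral `I_t(x)`. -/
def It (Q g : (Fin d → ℤ) → ℝ) (t : ℝ) (x : Fin d → ℤ) : ℂ :=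
  (((2 * π) ^ d : ℝ) : ℂ)⁻¹ *
    ∫ k in torus d, Complex.exp (Complex.I * (rdotZ k x : ℂ)) * fourierZ g k *
      Complex.exp (-(t : ℂ) * (fourierZ Q 0 - fourierZ Q k))

/-- The quantity `G_Q(x)`. -/
def GQ (Q g : (Fin d → ℤ) → ℝ) (x : Fin d → ℤ) : ℂ :=
  ∫ t in Set.Ioi (0 : ℝ), It Q g t x

/-- The Kronecker delta at the origin. -/
def deltaZ (d : ℕ) : (Fin d → ℤ) → ℝ := fun x => if x = 0 then 1 else 0

/-- n-fold convolution power. -/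
def convPow (D : (Fin d → ℤ) → ℝ) : ℕ → (Fin d → ℤ) → ℝ
  | 0 => deltaZ d
  | n + 1 => conv D (convPow D n)

/-- Random-walk Green function `S_z(x) = ∑_n z^n D^{*n}(x)`. -/
def rwG (D : (Fin d → ℤ) → ℝ) (z : ℝ) (x : Fin d → ℤ) : ℝ :=
  ∑' n : ℕ, z ^ n * convPow D n x

/-- `σ² = ∑_x ‖x‖₂² J(x)`. -/
def sigmaSq (J : (Fin d → ℤ) → ℝ) : ℝ := ∑' x, enormZ x ^ 2 * J x

/-- Susceptibility `χ = ∑_x S(x)`. -/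
def suscept (S : (Fin d → ℤ) → ℝ) : ℝ := ∑' x, S x

/-- `ĥ(0) = ∑_x h(x)`. -/
def h0 (h : (Fin d → ℤ) → ℝ) : ℝ := ∑' x, h x

/-- Correlation length of order φ. -/
def xiPhi (S : (Fin d → ℤ) → ℝ) (φ : ℝ) : ℝ :=
  ((∑' x, enormZ x ^ φ * S x) / suscept S) ^ (1 / φ)

/-- A critical family of OZ systems. -/
structure CriticalFamily (d : ℕ) (δ zc M K ζ : ℝ) (S J h : ℝ → (Fin d → ℤ) → ℝ) : Prop where
  δ_pos : 0 < δ
  assumOmega : ∀ z ∈ Set.Ico (zc - δ) zc, AssumptionOmega (S z)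
  assumJ : ∀ z ∈ Set.Ico (zc - δ) zc, AssumptionJ (S z) (J z) (h z) M K ζ
  mass_tendsto : Tendsto (fun z => mass (S z)) (𝓝[<] zc) (𝓝 0)

/-- Convolution on ℤ. -/
def convZ (f g : ℤ → ℝ) (x : ℤ) : ℝ := ∑' y, f (x - y) * g y

/-- n-fold convolution power on ℤ. -/
def convZPow (f : ℤ → ℝ) : ℕ → ℤ → ℝ
  | 0 => fun x => if x = 0 then 1 else 0
  | n + 1 => convZ f (convZPow f n)

/-! ### Elementary estimates on lattice vectors -/

lemma enormZ_nonneg (x : Fin d → ℤ) : 0 ≤ enormZ x := Real.sqrt_nonneg _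

lemma abs_coord_le_enormZ (x : Fin d → ℤ) (i : Fin d) : |(x i : ℝ)| ≤ enormZ x := by
  apply Real.abs_le_sqrt
  exact Finset.single_le_sum (f := fun i => (x i : ℝ) ^ 2) (fun _ _ => sq_nonneg _)
    (Finset.mem_univ i)

lemma enormZ_zero : enormZ (0 : Fin d → ℤ) = 0 := by simp [enormZ]

lemma rdotZ_le {R : ℝ} {μ : Fin d → ℝ} (hμ : ∀ i, |μ i| ≤ R) (x : Fin d → ℤ) :
    rdotZ μ x ≤ d * R * enormZ x := by
  have h : ∀ i, μ i * (x i : ℝ) ≤ R * enormZ x := fun i =>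
    calc μ i * (x i : ℝ) ≤ |μ i * (x i : ℝ)| := le_abs_self _
      _ = |μ i| * |(x i : ℝ)| := abs_mul _ _
      _ ≤ R * enormZ x := mul_le_mul (hμ i) (abs_coord_le_enormZ x i) (abs_nonneg _)
          ((abs_nonneg _).trans (hμ i))
  calc rdotZ μ x ≤ ∑ _i : Fin d, R * enormZ x := Finset.sum_le_sum fun i _ => h i
    _ = d * R * enormZ x := by simp; ring

lemma rdotZ_zero_left (x : Fin d → ℤ) : rdotZ 0 x = 0 := by simp [rdotZ]

lemma rdotZ_zero (μ : Fin d → ℝ) : rdotZ μ 0 = 0 := by simp [rdotZ]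

lemma rdotZ_add (μ : Fin d → ℝ) (x y : Fin d → ℤ) :
    rdotZ μ (x + y) = rdotZ μ x + rdotZ μ y := by
  simp [rdotZ, mul_add, Finset.sum_add_distrib]

lemma rdotZ_neg (μ : Fin d → ℝ) (x : Fin d → ℤ) : rdotZ μ (-x) = -rdotZ μ x := by
  simp [rdotZ]

lemma rdotZ_single (μ : Fin d → ℝ) (i : Fin d) : rdotZ μ (Pi.single i 1) = μ i := by
  classical
  simp [rdotZ, Pi.single_apply]

lemma continuous_rdotZ (x : Fin d → ℤ) : Continuous fun μ : Fin d → ℝ => rdotZ μ x := by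
  unfold rdotZ
  fun_prop

/-! ### Summability of exponentials on the lattice -/

lemma summable_pi_prod {f : ℤ → ℝ} (hf0 : ∀ n, 0 ≤ f n) (hf : Summable f) (n : ℕ) :
    Summable fun x : Fin n → ℤ => ∏ i, f (x i) := by
  induction n with
  | zero => exact Summable.of_finite
  | succ n ih =>
    rw [← (Fin.consEquiv fun _ => ℤ).summable_iff]
    have := hf.mul_of_nonneg ih hf0 fun x => Finset.prod_nonneg fun i _ => hf0 _
    refine this.congr fun p => ?_
    simp [Fin.prod_univ_succ, Fin.consEquiv]

lemma summable_exp_neg_abs {c : ℝ} (hc : 0 < c) :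
    Summable fun n : ℤ => Real.exp (-(c * |(n : ℝ)|)) := by
  have h : Summable fun n : ℕ => Real.exp (n * -c) :=
    Real.summable_exp_nat_mul_iff.2 (by linarith)
  refine Summable.of_nat_of_neg ?_ ?_
  · refine h.congr fun n => ?_
    simp [mul_comm]
  · refine h.congr fun n => ?_
    simp [mul_comm]

lemma summable_exp_neg_enormZ {c : ℝ} (hc : 0 < c) :
    Summable fun x : Fin d → ℤ => Real.exp (-(c * enormZ x)) := by
  rcases Nat.eq_zero_or_pos d with rfl | hd
  · exact Summable.of_finite
  have hd' : (0 : ℝ) < d := by exact_mod_cast hd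
  refine Summable.of_nonneg_of_le (fun _ => (Real.exp_pos _).le) (fun x => ?_)
    (summable_pi_prod (fun _ => (Real.exp_pos _).le) (summable_exp_neg_abs (div_pos hc hd')) d)
  rw [← Real.exp_sum]
  apply Real.exp_le_exp.2
  rw [Finset.sum_neg_distrib, neg_le_neg_iff, ← Finset.mul_sum]
  have : ∑ i, |(x i : ℝ)| ≤ d * enormZ x := by
    calc ∑ i, |(x i : ℝ)| ≤ ∑ _i : Fin d, enormZ x :=
          Finset.sum_le_sum fun i _ => abs_coord_le_enormZ x i
      _ = d * enormZ x := by simp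
  calc c / d * ∑ i, |(x i : ℝ)| ≤ c / d * (d * enormZ x) := by gcongr
    _ = c * enormZ x := by field_simp

/-- A kernel decaying faster than every exponential. -/
def SuperExpDecay (D : (Fin d → ℤ) → ℝ) : Prop :=
  ∀ a : ℝ, 0 < a → Tendsto (fun x => D x * Real.exp (a * enormZ x)) cofinite (𝓝 0)

lemma SuperExpDecay.exists_tilt_le {D : (Fin d → ℤ) → ℝ} (h : SuperExpDecay D)
    (hD : ∀ x, 0 ≤ D x) {R r : ℝ} (hR : 0 ≤ R) (hr : 0 ≤ r) :
    ∃ C : ℝ, 0 ≤ C ∧ ∀ μ : Fin d → ℝ, (∀ i, |μ i| ≤ R) → ∀ x,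
      enormZ x ^ r * (D x * Real.exp (rdotZ μ x)) ≤ C * Real.exp (-enormZ x) := by
  have ha : 0 < d * R + r + 1 := by positivity
  obtain ⟨C, hC⟩ := (h _ ha).bddAbove_range_of_cofinite
  have hC' : ∀ x, D x * Real.exp ((d * R + r + 1) * enormZ x) ≤ C := fun x => hC ⟨x, rfl⟩
  refine ⟨C, (mul_nonneg (hD 0) (Real.exp_pos _).le).trans (hC' 0), fun μ hμ x => ?_⟩
  have hx := enormZ_nonneg x
  have h1 : enormZ x ^ r ≤ Real.exp (r * enormZ x) := by
    rw [mul_comm, Real.exp_mul]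
    exact Real.rpow_le_rpow hx (by linarith [Real.add_one_le_exp (enormZ x)]) hr
  have h2 : Real.exp (rdotZ μ x) ≤ Real.exp (d * R * enormZ x) :=
    Real.exp_le_exp.2 (rdotZ_le hμ x)
  calc enormZ x ^ r * (D x * Real.exp (rdotZ μ x))
      ≤ Real.exp (r * enormZ x) * (D x * Real.exp (d * R * enormZ x)) := by
        have := hD x
        gcongr
    _ = D x * Real.exp ((d * R + r + 1) * enormZ x) * Real.exp (-enormZ x) := by
        have : (d * R + r + 1) * enormZ x + -enormZ x = r * enormZ x + d * R * enormZ x := by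
          ring
        rw [mul_assoc (D x), ← Real.exp_add, this, Real.exp_add]
        ring
    _ ≤ C * Real.exp (-enormZ x) := by
        gcongr
        exact hC' x

lemma SuperExpDecay.exists_tilt_le' {D : (Fin d → ℤ) → ℝ} (h : SuperExpDecay D)
    (hD : ∀ x, 0 ≤ D x) {R : ℝ} (hR : 0 ≤ R) :
    ∃ C : ℝ, 0 ≤ C ∧ ∀ μ : Fin d → ℝ, (∀ i, |μ i| ≤ R) → ∀ x,
      D x * Real.exp (rdotZ μ x) ≤ C * Real.exp (-enormZ x) := by
  simpa using h.exists_tilt_le hD hR le_rfl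

lemma SuperExpDecay.summable_tilt {D : (Fin d → ℤ) → ℝ} (h : SuperExpDecay D)
    (hD : ∀ x, 0 ≤ D x) (μ : Fin d → ℝ) :
    Summable fun x => D x * Real.exp (rdotZ μ x) := by
  obtain ⟨C, -, hC⟩ := h.exists_tilt_le' hD (R := ∑ i, |μ i|)
    (Finset.sum_nonneg fun _ _ => abs_nonneg _)
  have hs : Summable fun x : Fin d → ℤ => C * Real.exp (-enormZ x) := by
    simpa using (summable_exp_neg_enormZ (d := d) one_pos).mul_left C
  exact Summable.of_nonneg_of_le (fun x => mul_nonneg (hD x) (Real.exp_pos _).le)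
    (hC μ fun i => Finset.single_le_sum (f := fun i => |μ i|) (fun _ _ => abs_nonneg _)
      (Finset.mem_univ i)) hs

lemma SuperExpDecay.continuous_tiltSum {D : (Fin d → ℤ) → ℝ} (h : SuperExpDecay D)
    (hD : ∀ x, 0 ≤ D x) : Continuous (tiltSum D) := by
  rw [continuous_iff_continuousAt]
  intro μ₀
  obtain ⟨C, -, hC⟩ := h.exists_tilt_le' hD (R := ‖μ₀‖ + 1) (by positivity)
  have hs : Summable fun x : Fin d → ℤ => C * Real.exp (-enormZ x) := by
    simpa using (summable_exp_neg_enormZ (d := d) one_pos).mul_left C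
  have hcont : ContinuousOn (fun μ => ∑' x, D x * Real.exp (rdotZ μ x))
      (Metric.ball μ₀ 1) := by
    refine continuousOn_tsum (fun x => ?_) hs fun x μ hμ => ?_
    · exact (continuous_const.mul (Real.continuous_exp.comp (continuous_rdotZ x))).continuousOn
    · rw [Real.norm_of_nonneg (mul_nonneg (hD x) (Real.exp_pos _).le)]
      refine hC μ (fun i => ?_) x
      have h1 : ‖μ - μ₀‖ < 1 := by simpa [dist_eq_norm] using hμ
      have h2 := norm_le_norm_add_norm_sub' μ μ₀
      have h3 : ‖μ i‖ ≤ ‖μ‖ := norm_le_pi_norm μ i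
      rw [Real.norm_eq_abs] at h3
      linarith
  exact hcont.continuousAt (Metric.ball_mem_nhds _ one_pos)

lemma SuperExpDecay.exists_lpNorm_tilt_le {D : (Fin d → ℤ) → ℝ} (h : SuperExpDecay D)
    (hD : ∀ x, 0 ≤ D x) {R r p : ℝ} (hR : 0 ≤ R) (hr : 0 ≤ r) (hp : 0 < p) :
    ∃ M : ℝ, ∀ z, 0 ≤ z → z ≤ 1 → ∀ μ : Fin d → ℝ, (∀ i, |μ i| ≤ R) →
      lpNorm (fun y => enormZ y ^ r * tilt (fun x => z * D x) μ y) p ≤ ENNReal.ofReal M := by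
  obtain ⟨C, hC0, hC⟩ := h.exists_tilt_le hD hR hr
  have hs : Summable fun x : Fin d → ℤ => (C * Real.exp (-enormZ x)) ^ p := by
    refine ((summable_exp_neg_enormZ (d := d) hp).mul_left (C ^ p)).congr fun x => ?_
    rw [Real.mul_rpow hC0 (Real.exp_pos _).le, ← Real.exp_mul]
    ring_nf
  refine ⟨((∑' x : Fin d → ℤ,
    ENNReal.ofReal ((C * Real.exp (-enormZ x)) ^ p)) ^ (1 / p)).toReal, ?_⟩
  intro z hz0 hz1 μ hμ
  rw [ENNReal.ofReal_toReal (ENNReal.rpow_ne_top_of_nonneg (by positivity) hs.tsum_ofReal_ne_top)]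
  unfold lpNorm
  refine ENNReal.rpow_le_rpow (ENNReal.tsum_le_tsum fun x => ENNReal.ofReal_le_ofReal ?_)
    (by positivity)
  refine Real.rpow_le_rpow (abs_nonneg _) ?_ hp.le
  have hx : 0 ≤ enormZ x ^ r * (D x * Real.exp (rdotZ μ x)) :=
    mul_nonneg (Real.rpow_nonneg (enormZ_nonneg x) _) (mul_nonneg (hD x) (Real.exp_pos _).le)
  have he : enormZ x ^ r * tilt (fun x => z * D x) μ x =
      z * (enormZ x ^ r * (D x * Real.exp (rdotZ μ x))) := by
    simp only [tilt]
    ring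
  beta_reduce
  rw [he, abs_of_nonneg (mul_nonneg hz0 hx)]
  exact (mul_le_of_le_one_left hx hz1).trans (hC μ hμ x)

/-! ### Symmetry -/

lemma ZdSymmetric.neg {f : (Fin d → ℤ) → ℝ} (hf : ZdSymmetric f) (x : Fin d → ℤ) :
    f (-x) = f x :=
  hf.2 (fun _ => true) x

lemma ZdSymmetric.const_mul {f : (Fin d → ℤ) → ℝ} (hf : ZdSymmetric f) (c : ℝ) :
    ZdSymmetric fun x => c * f x :=
  ⟨fun σ x => by simp only [hf.1 σ x], fun ε x => by simp only [hf.2 ε x]⟩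

lemma zdSymmetric_deltaZ : ZdSymmetric (deltaZ d) := by
  constructor
  · intro σ x
    have : (fun i => x (σ i)) = 0 ↔ x = 0 := by
      simp only [funext_iff, Pi.zero_apply]
      exact σ.forall_congr_right (q := fun i => x i = 0)
    simp only [deltaZ, this]
  · intro ε x
    have : (fun i => if ε i then -(x i) else x i) = 0 ↔ x = 0 := by
      simp only [funext_iff, Pi.zero_apply]
      refine forall_congr' fun i => ?_
      split_ifs <;> simp
    simp only [deltaZ, this]

lemma conv_comp_equiv {f g : (Fin d → ℤ) → ℝ} (e : (Fin d → ℤ) ≃ (Fin d → ℤ))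
    (he : ∀ x y, e (x - y) = e x - e y) (hf : ∀ x, f (e x) = f x) (hg : ∀ x, g (e x) = g x)
    (x : Fin d → ℤ) : conv f g (e x) = conv f g x := by
  unfold conv
  rw [← e.tsum_eq]
  simp only [← he, hf, hg]

/-- Negation of the coordinates selected by `ε`. -/
def reflectEquiv (ε : Fin d → Bool) : (Fin d → ℤ) ≃ (Fin d → ℤ) :=
  Function.Involutive.toPerm (fun x i => if ε i then -(x i) else x i) fun x => by
    funext i
    dsimp only
    split_ifs <;> simp

lemma ZdSymmetric.conv {f g : (Fin d → ℤ) → ℝ} (hf : ZdSymmetric f) (hg : ZdSymmetric g) :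
    ZdSymmetric (conv f g) := by
  constructor
  · intro σ x
    exact conv_comp_equiv (σ.symm.arrowCongr (Equiv.refl ℤ)) (fun _ _ => rfl) (hf.1 σ) (hg.1 σ) x
  · intro ε x
    refine conv_comp_equiv (reflectEquiv ε) (fun x y => ?_) (hf.2 ε) (hg.2 ε) x
    funext i
    change (if ε i then -(x i - y i) else x i - y i) =
      (if ε i then -(x i) else x i) - (if ε i then -(y i) else y i)
    split_ifs <;> ring

lemma ZdSymmetric.convPow {D : (Fin d → ℤ) → ℝ} (hD : ZdSymmetric D) (n : ℕ) :
    ZdSymmetric (convPow D n) := by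
  induction n with
  | zero => exact zdSymmetric_deltaZ
  | succ n ih => exact hD.conv ih

lemma ZdSymmetric.rwG {D : (Fin d → ℤ) → ℝ} (hD : ZdSymmetric D) (z : ℝ) :
    ZdSymmetric (rwG D z) :=
  ⟨fun σ x => by simp only [OZpaper.rwG, (hD.convPow _).1 σ x],
    fun ε x => by simp only [OZpaper.rwG, (hD.convPow _).2 ε x]⟩

/-! ### Convolution powers and the Green function -/

lemma summable_comp_sub_left {D : (Fin d → ℤ) → ℝ} (hs : Summable D) (x : Fin d → ℤ) :
    Summable fun y => D (x - y) :=
  hs.comp_injective (Equiv.subLeft x).injective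

lemma convPow_mem_Icc {D : (Fin d → ℤ) → ℝ} (hD : ∀ x, 0 ≤ D x) (hs : Summable D)
    (h1 : ∑' x, D x = 1) (n : ℕ) (x : Fin d → ℤ) :
    0 ≤ convPow D n x ∧ convPow D n x ≤ 1 := by
  induction n generalizing x with
  | zero =>
    simp only [convPow, deltaZ]
    split_ifs <;> norm_num
  | succ n ih =>
    have hb : ∀ y, D (x - y) * convPow D n y ≤ D (x - y) :=
      fun y => mul_le_of_le_one_right (hD _) (ih y).2
    have hn : ∀ y, 0 ≤ D (x - y) * convPow D n y := fun y => mul_nonneg (hD _) (ih y).1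
    have hx := summable_comp_sub_left hs x
    refine ⟨tsum_nonneg hn, ?_⟩
    calc conv D (convPow D n) x ≤ ∑' y, D (x - y) :=
          (Summable.of_nonneg_of_le hn hb hx).tsum_le_tsum hb hx
      _ = ∑' y, D y := (Equiv.subLeft x).tsum_eq D
      _ = 1 := h1

lemma summable_rwG {D : (Fin d → ℤ) → ℝ} (hD : ∀ x, 0 ≤ D x) (hs : Summable D)
    (h1 : ∑' x, D x = 1) {z : ℝ} (hz : z ∈ Set.Ioo (0 : ℝ) 1) (x : Fin d → ℤ) :
    Summable fun n : ℕ => z ^ n * convPow D n x :=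
  Summable.of_nonneg_of_le
    (fun n => mul_nonneg (pow_nonneg hz.1.le n) (convPow_mem_Icc hD hs h1 n x).1)
    (fun n => mul_le_of_le_one_right (pow_nonneg hz.1.le n) (convPow_mem_Icc hD hs h1 n x).2)
    (summable_geometric_of_lt_one hz.1.le hz.2)

lemma chi_convPow {D : (Fin d → ℤ) → ℝ} (hD : ∀ x, 0 ≤ D x) (hs : Summable D)
    (h1 : ∑' x, D x = 1) (μ : Fin d → ℝ) (n : ℕ) :
    chi (convPow D n) μ = chi D μ ^ n := by
  induction n with
  | zero =>
    rw [pow_zero, chi, tsum_eq_single 0]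
    · simp [convPow, deltaZ, rdotZ_zero]
    · intro x hx
      simp [convPow, deltaZ, hx]
  | succ n ih =>
    have hmem := convPow_mem_Icc hD hs h1 n
    have key : ∀ x, ENNReal.ofReal (conv D (convPow D n) x * Real.exp (rdotZ μ x)) =
        ∑' y, ENNReal.ofReal (D (x - y) * Real.exp (rdotZ μ (x - y))) *
          ENNReal.ofReal (convPow D n y * Real.exp (rdotZ μ y)) := by
      intro x
      have hn : ∀ y, 0 ≤ D (x - y) * convPow D n y := fun y => mul_nonneg (hD _) (hmem y).1
      have hsum : Summable fun y => D (x - y) * convPow D n y :=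
        Summable.of_nonneg_of_le hn (fun y => mul_le_of_le_one_right (hD _) (hmem y).2)
          (summable_comp_sub_left hs x)
      rw [conv, ← tsum_mul_right, ENNReal.ofReal_tsum_of_nonneg
        (fun y => mul_nonneg (hn y) (Real.exp_pos _).le) (hsum.mul_right _)]
      refine tsum_congr fun y => ?_
      rw [← ENNReal.ofReal_mul (mul_nonneg (hD _) (Real.exp_pos _).le)]
      congr 1
      have : rdotZ μ x = rdotZ μ (x - y) + rdotZ μ y := by rw [← rdotZ_add, sub_add_cancel]
      rw [this, Real.exp_add]
      ring
    calc chi (convPow D (n + 1)) μ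
        = ∑' x, ∑' y, ENNReal.ofReal (D (x - y) * Real.exp (rdotZ μ (x - y))) *
          ENNReal.ofReal (convPow D n y * Real.exp (rdotZ μ y)) := tsum_congr key
      _ = ∑' y, ∑' x, ENNReal.ofReal (D (x - y) * Real.exp (rdotZ μ (x - y))) *
          ENNReal.ofReal (convPow D n y * Real.exp (rdotZ μ y)) := ENNReal.tsum_comm
      _ = ∑' y, chi D μ * ENNReal.ofReal (convPow D n y * Real.exp (rdotZ μ y)) := by
          refine tsum_congr fun y => ?_
          rw [ENNReal.tsum_mul_right]
          congr 1
          exact (Equiv.subRight y).tsum_eq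
            fun x => ENNReal.ofReal (D x * Real.exp (rdotZ μ x))
      _ = chi D μ * chi (convPow D n) μ := ENNReal.tsum_mul_left
      _ = chi D μ ^ (n + 1) := by rw [ih, pow_succ']

lemma chi_rwG {D : (Fin d → ℤ) → ℝ} (hD : ∀ x, 0 ≤ D x) (hs : Summable D)
    (h1 : ∑' x, D x = 1) {z : ℝ} (hz : z ∈ Set.Ioo (0 : ℝ) 1) (μ : Fin d → ℝ) :
    chi (rwG D z) μ = (1 - ENNReal.ofReal z * chi D μ)⁻¹ := by
  have hz0 := hz.1.le
  calc chi (rwG D z) μ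
      = ∑' x, ∑' n : ℕ, ENNReal.ofReal z ^ n *
          ENNReal.ofReal (convPow D n x * Real.exp (rdotZ μ x)) := by
        refine tsum_congr fun x => ?_
        rw [rwG, ← tsum_mul_right, ENNReal.ofReal_tsum_of_nonneg
          (fun n => mul_nonneg (mul_nonneg (pow_nonneg hz0 n)
            (convPow_mem_Icc hD hs h1 n x).1) (Real.exp_pos _).le)
          ((summable_rwG hD hs h1 hz x).mul_right _)]
        refine tsum_congr fun n => ?_
        rw [← ENNReal.ofReal_pow hz0, ← ENNReal.ofReal_mul (pow_nonneg hz0 n), mul_assoc]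
    _ = ∑' n : ℕ, (ENNReal.ofReal z * chi D μ) ^ n := by
        rw [ENNReal.tsum_comm]
        refine tsum_congr fun n => ?_
        rw [ENNReal.tsum_mul_left, mul_pow, ← chi_convPow hD hs h1]
        rfl
    _ = _ := ENNReal.tsum_geometric _

lemma SuperExpDecay.mem_Omega_rwG {D : (Fin d → ℤ) → ℝ} (h : SuperExpDecay D)
    (hD : ∀ x, 0 ≤ D x) (hs : Summable D) (h1 : ∑' x, D x = 1) {z : ℝ}
    (hz : z ∈ Set.Ioo (0 : ℝ) 1) (μ : Fin d → ℝ) :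
    μ ∈ Omega (rwG D z) ↔ z * tiltSum D μ < 1 := by
  have hchi : chi D μ = ENNReal.ofReal (tiltSum D μ) :=
    (ENNReal.ofReal_tsum_of_nonneg (fun x => mul_nonneg (hD x) (Real.exp_pos _).le)
      (h.summable_tilt hD μ)).symm
  change chi (rwG D z) μ < ⊤ ↔ _
  rw [chi_rwG hD hs h1 hz, ENNReal.inv_lt_top, tsub_pos_iff_lt, hchi,
    ← ENNReal.ofReal_mul hz.1.le, ENNReal.ofReal_lt_one]

lemma rwG_ornsteinZernike {D : (Fin d → ℤ) → ℝ} (hD : ∀ x, 0 ≤ D x) (hs : Summable D)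
    (h1 : ∑' x, D x = 1) {z : ℝ} (hz : z ∈ Set.Ioo (0 : ℝ) 1) (x : Fin d → ℤ) :
    rwG D z x = deltaZ d x + conv (fun x => z * D x) (rwG D z) x := by
  have hz0 := hz.1.le
  have hmem := convPow_mem_Icc hD hs h1
  have hsum : Summable fun p : (Fin d → ℤ) × ℕ =>
      z * D (x - p.1) * (z ^ p.2 * convPow D p.2 p.1) := by
    refine Summable.of_nonneg_of_le (fun p => mul_nonneg (mul_nonneg hz0 (hD _))
      (mul_nonneg (pow_nonneg hz0 _) (hmem _ _).1)) (fun p => ?_)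
      (((summable_comp_sub_left hs x).mul_left z).mul_of_nonneg
        (summable_geometric_of_lt_one hz0 hz.2) (fun y => mul_nonneg hz0 (hD _))
        fun n => pow_nonneg hz0 n)
    exact mul_le_mul_of_nonneg_left
      (mul_le_of_le_one_right (pow_nonneg hz0 _) (hmem _ _).2) (mul_nonneg hz0 (hD _))
  have hconv : conv (fun x => z * D x) (rwG D z) x =
      ∑' n : ℕ, z ^ (n + 1) * convPow D (n + 1) x := by
    calc conv (fun x => z * D x) (rwG D z) x
        = ∑' y, ∑' n : ℕ, z * D (x - y) * (z ^ n * convPow D n y) :=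
          tsum_congr fun y => tsum_mul_left.symm
      _ = ∑' n : ℕ, ∑' y, z * D (x - y) * (z ^ n * convPow D n y) :=
          Summable.tsum_comm
            (f := fun y n => z * D (x - y) * (z ^ n * convPow D n y)) hsum |>.symm
      _ = ∑' n : ℕ, z ^ (n + 1) * convPow D (n + 1) x := by
          refine tsum_congr fun n => ?_
          simp only [convPow, conv]
          rw [← tsum_mul_left]
          refine tsum_congr fun y => ?_
          ring
  rw [hconv, rwG, (summable_rwG hD hs h1 hz x).tsum_eq_zero_add]
  simp [convPow]

/-! ### Lower bounds from the nondegeneracy of the support -/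

lemma exists_exp_le_tiltSum (hd : 1 ≤ d) {D : (Fin d → ℤ) → ℝ} (hD : ∀ x, 0 ≤ D x)
    (hsym : ZdSymmetric D) (hsupp : ∀ L : AddSubgroup (Fin d → ℤ), (∀ x, D x ≠ 0 → x ∈ L) → L = ⊤)
    (hsum : ∀ μ, Summable fun x => D x * Real.exp (rdotZ μ x)) :
    ∃ c : ℝ, 0 < c ∧ ∀ (μ : Fin d → ℝ) (i : Fin d), c * Real.exp |μ i| ≤ tiltSum D μ := by
  obtain ⟨y, hy, hy0⟩ : ∃ y, D y ≠ 0 ∧ y ≠ 0 := by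
    by_contra! hcon
    have hbot := hsupp ⊥ fun x hx => by simpa using hcon x hx
    have : (Pi.single ⟨0, hd⟩ 1 : Fin d → ℤ) ∈ (⊥ : AddSubgroup (Fin d → ℤ)) := by
      rw [hbot]; trivial
    simp at this
  obtain ⟨j, hj⟩ := Function.ne_iff.1 hy0
  refine ⟨D y, (hD y).lt_of_ne' hy, fun μ i => ?_⟩
  classical
  set u : Fin d → ℤ := fun l => y (Equiv.swap i j l) with hu
  set w : Fin d → ℤ := fun l => if decide (μ l * (u l : ℝ) < 0) then -(u l) else u l with hw
  have hDw : D w = D y := (hsym.2 _ u).trans (hsym.1 _ y)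
  have hterm : ∀ l, μ l * (w l : ℝ) = |μ l * (u l : ℝ)| := by
    intro l
    simp only [hw, decide_eq_true_eq]
    split_ifs with hl
    · rw [abs_of_neg hl]; push_cast; ring
    · rw [abs_of_nonneg (not_lt.1 hl)]
  have hdot : |μ i| ≤ rdotZ μ w := by
    have h1 : (1 : ℝ) ≤ |(u i : ℝ)| := by
      have : u i ≠ 0 := by simpa [hu] using hj
      exact_mod_cast Int.one_le_abs this
    calc |μ i| ≤ |μ i| * |(u i : ℝ)| := le_mul_of_one_le_right (abs_nonneg _) h1
      _ = |μ i * (u i : ℝ)| := (abs_mul _ _).symm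
      _ ≤ ∑ l, |μ l * (u l : ℝ)| := Finset.single_le_sum (f := fun l => |μ l * (u l : ℝ)|)
          (fun _ _ => abs_nonneg _) (Finset.mem_univ i)
      _ = rdotZ μ w := Finset.sum_congr rfl fun l _ => (hterm l).symm
  calc D y * Real.exp |μ i| ≤ D w * Real.exp (rdotZ μ w) := by
        rw [hDw]
        exact mul_le_mul_of_nonneg_left (Real.exp_le_exp.2 hdot) (hD y)
    _ ≤ tiltSum D μ := (hsum μ).le_tsum w fun x _ => mul_nonneg (hD x) (Real.exp_pos _).le

/-- The real part of `D̂(0) - D̂(k)`. -/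
def cosGap (D : (Fin d → ℤ) → ℝ) (k : Fin d → ℝ) : ℝ := ∑' y, D y * (1 - Real.cos (rdotZ k y))

lemma summable_cosGap {D : (Fin d → ℤ) → ℝ} (hD : ∀ x, 0 ≤ D x) (hs : Summable D)
    (k : Fin d → ℝ) : Summable fun y => D y * (1 - Real.cos (rdotZ k y)) :=
  Summable.of_nonneg_of_le
    (fun y => mul_nonneg (hD y) (by linarith [Real.cos_le_one (rdotZ k y)]))
    (fun y => mul_le_mul_of_nonneg_left (by linarith [Real.neg_one_le_cos (rdotZ k y)]) (hD y))
    (hs.mul_right 2)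

lemma cosGap_nonneg {D : (Fin d → ℤ) → ℝ} (hD : ∀ x, 0 ≤ D x) (k : Fin d → ℝ) :
    0 ≤ cosGap D k :=
  tsum_nonneg fun y => mul_nonneg (hD y) (by linarith [Real.cos_le_one (rdotZ k y)])

lemma sin_add_sq_le (a b : ℝ) :
    Real.sin (a + b) ^ 2 ≤ 2 * Real.sin a ^ 2 + 2 * Real.sin b ^ 2 := by
  have h : |Real.sin (a + b)| ≤ |Real.sin a| + |Real.sin b| := by
    rw [Real.sin_add]
    refine (abs_add_le _ _).trans (add_le_add ?_ ?_)
    · rw [abs_mul]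
      exact mul_le_of_le_one_right (abs_nonneg _) (Real.abs_cos_le_one _)
    · rw [abs_mul]
      exact mul_le_of_le_one_left (abs_nonneg _) (Real.abs_cos_le_one _)
  rw [← sq_abs (Real.sin (a + b)), ← sq_abs (Real.sin a), ← sq_abs (Real.sin b)]
  nlinarith [abs_nonneg (Real.sin (a + b)), sq_nonneg (|Real.sin a| - |Real.sin b|)]

/-- The lattice vectors `y` for which `sin² (k·y/2)` is controlled by `cosGap D k`. -/
def sinControlled (D : (Fin d → ℤ) → ℝ) : AddSubgroup (Fin d → ℤ) where
  carrier := {y | ∃ C : ℝ, 0 ≤ C ∧ ∀ k, Real.sin (rdotZ k y / 2) ^ 2 ≤ C * cosGap D k}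
  zero_mem' := ⟨0, le_rfl, fun k => by simp [rdotZ_zero]⟩
  add_mem' := by
    rintro x y ⟨A, hA0, hA⟩ ⟨B, hB0, hB⟩
    refine ⟨2 * A + 2 * B, by positivity, fun k => ?_⟩
    rw [rdotZ_add, add_div]
    linarith [sin_add_sq_le (rdotZ k x / 2) (rdotZ k y / 2), hA k, hB k]
  neg_mem' := by
    rintro x ⟨A, hA0, hA⟩
    refine ⟨A, hA0, fun k => ?_⟩
    rw [rdotZ_neg, neg_div, Real.sin_neg, neg_sq]
    exact hA k

lemma mem_sinControlled {D : (Fin d → ℤ) → ℝ} (hD : ∀ x, 0 ≤ D x) (hs : Summable D)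
    {y : Fin d → ℤ} (hy : D y ≠ 0) : y ∈ sinControlled D := by
  have hpos : 0 < D y := (hD y).lt_of_ne' hy
  refine ⟨(D y)⁻¹, by positivity, fun k => ?_⟩
  have h1 : D y * (1 - Real.cos (rdotZ k y)) ≤ cosGap D k :=
    (summable_cosGap hD hs k).le_tsum y fun x _ =>
      mul_nonneg (hD x) (by linarith [Real.cos_le_one (rdotZ k x)])
  have h2 : 1 - Real.cos (rdotZ k y) = 2 * Real.sin (rdotZ k y / 2) ^ 2 := by
    have := Real.cos_sq (rdotZ k y / 2)
    rw [mul_div_cancel₀ _ two_ne_zero] at this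
    rw [Real.sin_sq]
    linarith
  rw [le_inv_mul_iff₀ hpos]
  refine le_trans (mul_le_mul_of_nonneg_left ?_ (hD y)) h1
  rw [h2]
  linarith [sq_nonneg (Real.sin (rdotZ k y / 2))]

lemma sq_le_pi_sq_mul_sin_half_sq {t : ℝ} (ht : |t| ≤ π) :
    t ^ 2 ≤ π ^ 2 * Real.sin (t / 2) ^ 2 := by
  have h := Real.mul_le_sin (x := |t| / 2) (by positivity) (by linarith)
  have h0 : |t| ≤ π * Real.sin (|t| / 2) := by
    have := mul_le_mul_of_nonneg_left h Real.pi_pos.le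
    calc |t| = π * (2 / π * (|t| / 2)) := by field_simp
      _ ≤ _ := this
  have h1 : Real.sin (|t| / 2) ^ 2 = Real.sin (t / 2) ^ 2 := by
    rcases abs_choice t with h | h <;> rw [h]
    rw [neg_div, Real.sin_neg, neg_sq]
  calc t ^ 2 = |t| ^ 2 := (sq_abs t).symm
    _ ≤ (π * Real.sin (|t| / 2)) ^ 2 := pow_le_pow_left₀ (abs_nonneg t) h0 2
    _ = _ := by rw [mul_pow, h1]

lemma exists_mul_sq_le_cosGap {D : (Fin d → ℤ) → ℝ} (hD : ∀ x, 0 ≤ D x) (hs : Summable D)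
    (hsupp : ∀ L : AddSubgroup (Fin d → ℤ), (∀ x, D x ≠ 0 → x ∈ L) → L = ⊤) :
    ∃ K : ℝ, 0 < K ∧ ∀ k : Fin d → ℝ, (∀ i, |k i| ≤ π) →
      K * enormR k ^ 2 ≤ cosGap D k := by
  have htop := hsupp (sinControlled D) fun x hx => mem_sinControlled hD hs hx
  have hmem : ∀ i : Fin d, ∃ C : ℝ, 0 ≤ C ∧ ∀ k : Fin d → ℝ,
      Real.sin (k i / 2) ^ 2 ≤ C * cosGap D k := by
    intro i
    have : (Pi.single i 1 : Fin d → ℤ) ∈ sinControlled D := by rw [htop]; trivial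
    obtain ⟨C, hC0, hC⟩ := this
    exact ⟨C, hC0, fun k => by simpa [rdotZ_single] using hC k⟩
  choose C hC0 hC using hmem
  have hA : 0 < π ^ 2 * ∑ i, C i + 1 :=
    add_pos_of_nonneg_of_pos
      (mul_nonneg (sq_nonneg _) (Finset.sum_nonneg fun i _ => hC0 i)) one_pos
  refine ⟨(π ^ 2 * ∑ i, C i + 1)⁻¹, inv_pos.2 hA, fun k hk => ?_⟩
  rw [inv_mul_le_iff₀ hA, enormR, Real.sq_sqrt (Finset.sum_nonneg fun _ _ => sq_nonneg _)]
  calc ∑ i, k i ^ 2 ≤ ∑ i, π ^ 2 * (C i * cosGap D k) :=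
        Finset.sum_le_sum fun i _ => (sq_le_pi_sq_mul_sin_half_sq (hk i)).trans
          (mul_le_mul_of_nonneg_left (hC i k) (sq_nonneg _))
    _ = π ^ 2 * (∑ i, C i) * cosGap D k := by
        rw [← Finset.mul_sum, ← Finset.sum_mul, mul_assoc]
    _ ≤ (π ^ 2 * ∑ i, C i + 1) * cosGap D k :=
        mul_le_mul_of_nonneg_right (by linarith) (cosGap_nonneg hD k)

lemma fourierZ_re {Q : (Fin d → ℤ) → ℝ} (hQ : Summable Q) (k : Fin d → ℝ) :
    (fourierZ Q k).re = ∑' y, Q y * Real.cos (rdotZ k y) := by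
  have hexp : ∀ y : Fin d → ℤ, -Complex.I * (rdotZ k y : ℂ) =
      ((-rdotZ k y : ℝ) : ℂ) * Complex.I := fun y => by push_cast; ring
  have hsum : Summable fun y => (Q y : ℂ) * Complex.exp (-Complex.I * (rdotZ k y : ℂ)) := by
    refine Summable.of_norm (hQ.abs.congr fun y => ?_)
    rw [norm_mul, hexp, Complex.norm_exp_ofReal_mul_I, mul_one, Complex.norm_real,
      Real.norm_eq_abs]
  rw [fourierZ, Complex.re_tsum hsum]
  refine tsum_congr fun y => ?_
  rw [Complex.re_ofReal_mul, hexp, Complex.exp_ofReal_mul_I_re, Real.cos_neg]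

lemma fourierZ_sub_re {Q : (Fin d → ℤ) → ℝ} (hQ0 : ∀ y, 0 ≤ Q y) (hQ : Summable Q)
    (k : Fin d → ℝ) : (fourierZ Q 0 - fourierZ Q k).re = cosGap Q k := by
  have hcos : Summable fun y => Q y * Real.cos (rdotZ k y) :=
    (hQ.sub (summable_cosGap hQ0 hQ k)).congr fun y => by ring
  rw [Complex.sub_re, fourierZ_re hQ, fourierZ_re hQ]
  simp only [rdotZ_zero_left, Real.cos_zero, mul_one]
  rw [← hQ.tsum_sub hcos]
  exact tsum_congr fun y => by ring

/-- Tilting a symmetric kernel does not decrease the cosine gap, since `cosh ≥ 1`. -/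
lemma cosGap_le_cosGap_tilt {D : (Fin d → ℤ) → ℝ} (hD : ∀ x, 0 ≤ D x) (hs : Summable D)
    (hsym : ZdSymmetric D) (μ k : Fin d → ℝ)
    (hsum : Summable fun x => D x * Real.exp (rdotZ μ x)) :
    cosGap D k ≤ cosGap (tilt D μ) k := by
  have hT := summable_cosGap (D := tilt D μ)
    (fun x => mul_nonneg (hD x) (Real.exp_pos _).le) hsum k
  have hTneg : Summable fun y => tilt D μ (-y) * (1 - Real.cos (rdotZ k (-y))) :=
    hT.comp_injective (Equiv.neg _).injective
  have hneg : ∑' y, tilt D μ (-y) * (1 - Real.cos (rdotZ k (-y))) = cosGap (tilt D μ) k :=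
    (Equiv.neg (Fin d → ℤ)).tsum_eq fun y => tilt D μ y * (1 - Real.cos (rdotZ k y))
  have h2 : 2 * cosGap D k ≤ cosGap (tilt D μ) k + cosGap (tilt D μ) k := by
    nth_rewrite 2 [← hneg]
    rw [cosGap, cosGap, ← tsum_mul_left, ← hT.tsum_add hTneg]
    refine ((summable_cosGap hD hs k).mul_left 2).tsum_le_tsum (fun y => ?_) (hT.add hTneg)
    simp only [tilt, hsym.neg, rdotZ_neg, Real.cos_neg]
    have h3 : 2 ≤ Real.exp (rdotZ μ y) + Real.exp (-rdotZ μ y) := by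
      linarith [Real.add_one_le_exp (rdotZ μ y), Real.add_one_le_exp (-rdotZ μ y)]
    have h4 : 0 ≤ D y * (1 - Real.cos (rdotZ k y)) :=
      mul_nonneg (hD y) (by linarith [Real.cos_le_one (rdotZ k y)])
    nlinarith [mul_le_mul_of_nonneg_left h3 h4]
  linarith

/-! ### The class `𝒬` -/

lemma lpNorm_zero {p : ℝ} (hp : 0 < p) : lpNorm (fun _ : Fin d → ℤ => 0) p = 0 := by
  simp [lpNorm, Real.zero_rpow hp.ne', hp]

lemma lpNorm_deltaZ_one : lpNorm (deltaZ d) 1 = 1 := by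
  rw [lpNorm, tsum_eq_single 0]
  · simp [deltaZ]
  · intro x hx
    simp [deltaZ, hx]

lemma enormZ_rpow_mul_deltaZ {r : ℝ} (hr : 0 < r) :
    (fun y => enormZ y ^ r * deltaZ d y) = fun _ => 0 := by
  funext y
  by_cases hy : y = 0
  · simp [hy, enormZ_zero, Real.zero_rpow hr.ne']
  · simp [deltaZ, hy]

lemma tilt_deltaZ (μ : Fin d → ℝ) : tilt (deltaZ d) μ = deltaZ d := by
  funext x
  by_cases hx : x = 0
  · simp [tilt, hx, rdotZ_zero]
  · simp [tilt, deltaZ, hx]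

lemma tiltSum_deltaZ (μ : Fin d → ℝ) : tiltSum (deltaZ d) μ = 1 := by
  rw [tiltSum, tsum_eq_single 0]
  · simp [deltaZ, rdotZ_zero]
  · intro x hx
    simp [deltaZ, hx]

lemma pExp_pos {ζ : ℝ} (hd : 1 ≤ d) (hζ : 0 < ζ) : 0 < pExp d ζ := by
  unfold pExp
  split_ifs with h
  · norm_num
  · have h2 : (2 : ℝ) ≤ d := by exact_mod_cast (by omega : 2 ≤ d)
    have h3 : 0 < min ζ 2 := lt_min hζ two_pos
    exact div_pos (by linarith) (by linarith)

lemma SuperExpDecay.exists_memQ (hd : 1 ≤ d) {D : (Fin d → ℤ) → ℝ} (h : SuperExpDecay D)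
    (hD : ∀ x, 0 ≤ D x) (hsym : ZdSymmetric D) (hs : Summable D)
    (hsupp : ∀ L : AddSubgroup (Fin d → ℤ), (∀ x, D x ≠ 0 → x ∈ L) → L = ⊤)
    {ε R ζ : ℝ} (hε : 0 < ε) (hR : 0 ≤ R) (hζ : 0 < ζ) :
    ∃ M K : ℝ, 0 < M ∧ 0 < K ∧ ∀ z ∈ Set.Ico ε (1 : ℝ), ∀ μ : Fin d → ℝ, (∀ i, |μ i| ≤ R) →
      MemQ M K ζ (tilt (fun x => z * D x) μ) (deltaZ d) := by
  have hd0 : (0 : ℝ) < d := by exact_mod_cast hd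
  have hd1 : (1 : ℝ) ≤ d := by exact_mod_cast hd
  obtain ⟨M₁, hM₁⟩ := h.exists_lpNorm_tilt_le hD hR le_rfl one_pos
  obtain ⟨M₂, hM₂⟩ := h.exists_lpNorm_tilt_le hD hR (r := 2 + ζ) (by positivity) one_pos
  obtain ⟨M₃, hM₃⟩ := h.exists_lpNorm_tilt_le hD hR (r := (d : ℝ) - 1) (by linarith)
    (p := min ((d : ℝ) / 3) 2) (lt_min (by positivity) two_pos)
  obtain ⟨K, hK, hKb⟩ := exists_mul_sq_le_cosGap hD hs hsupp
  have hmax : ∀ M, M = 1 ∨ M = M₁ ∨ M = M₂ ∨ M = M₃ →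
      ENNReal.ofReal M ≤ ENNReal.ofReal (max (max 1 M₁) (max M₂ M₃)) := by
    intro M hM
    apply ENNReal.ofReal_le_ofReal
    rcases hM with rfl | rfl | rfl | rfl <;> simp
  refine ⟨max (max 1 M₁) (max M₂ M₃), ε * K, by simp, mul_pos hε hK, fun z hz μ hμ => ?_⟩
  have hz0 : 0 ≤ z := hε.le.trans hz.1
  have hsum := h.summable_tilt hD μ
  have hzT : tilt (fun x => z * D x) μ = fun x => z * tilt D μ x := by
    funext x
    simp only [tilt]
    ring
  refine ⟨?_, (hM₂ z hz0 hz.2.le μ hμ).trans (hmax _ (by simp)), fun k hk => ?_, ?_, ?_, ?_,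
    fun _ => (hM₃ z hz0 hz.2.le μ hμ).trans (hmax _ (by simp)), fun h4 => ?_⟩
  · have := hM₁ z hz0 hz.2.le μ hμ
    simp only [Real.rpow_zero, one_mul] at this
    exact this.trans (hmax _ (by simp))
  · have hT0 : ∀ x, 0 ≤ tilt D μ x := fun x => mul_nonneg (hD x) (Real.exp_pos _).le
    rw [hzT, fourierZ_sub_re (fun x => mul_nonneg hz0 (hT0 x)) (hsum.mul_left z)]
    have hgap : cosGap (fun x => z * tilt D μ x) k = z * cosGap (tilt D μ) k := by
      rw [cosGap, cosGap, ← tsum_mul_left]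
      exact tsum_congr fun y => mul_assoc _ _ _
    rw [hgap, mul_assoc]
    exact mul_le_mul hz.1 ((hKb k hk).trans (cosGap_le_cosGap_tilt hD hs hsym μ k hsum))
      (by positivity) hz0
  · rw [lpNorm_deltaZ_one, ← ENNReal.ofReal_one]
    exact hmax _ (by simp)
  · rw [enormZ_rpow_mul_deltaZ hζ, lpNorm_zero one_pos]
    exact bot_le
  · rw [enormZ_rpow_mul_deltaZ two_pos, lpNorm_zero (lt_min (pExp_pos hd hζ) two_pos)]
    exact bot_le
  · have h4' : (4 : ℝ) ≤ d := by exact_mod_cast h4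
    rw [enormZ_rpow_mul_deltaZ (by linarith), lpNorm_zero two_pos]
    exact bot_le

/-- The tilts at which `S_z` has finite susceptibility are bounded, uniformly in `z ≥ ε`. -/
lemma SuperExpDecay.exists_abs_le_of_mem_closure (hd : 1 ≤ d) {D : (Fin d → ℤ) → ℝ}
    (h : SuperExpDecay D) (hD : ∀ x, 0 ≤ D x) (hsym : ZdSymmetric D) (hs : Summable D)
    (h1 : ∑' x, D x = 1)
    (hsupp : ∀ L : AddSubgroup (Fin d → ℤ), (∀ x, D x ≠ 0 → x ∈ L) → L = ⊤)
    {ε : ℝ} (hε : 0 < ε) :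
    ∃ R : ℝ, 0 ≤ R ∧ ∀ z ∈ Set.Ico ε (1 : ℝ), ∀ μ ∈ closure (Omega (rwG D z)),
      ∀ i, |μ i| ≤ R := by
  obtain ⟨c, hc, hcb⟩ := exists_exp_le_tiltSum hd hD hsym hsupp (h.summable_tilt hD)
  refine ⟨(ε * c)⁻¹, by positivity, fun z hz μ hμ i => ?_⟩
  have hsub : Omega (rwG D z) ⊆ {μ | |μ i| ≤ (ε * c)⁻¹} := by
    intro ν hν
    have hlt := (h.mem_Omega_rwG hD hs h1 ⟨hε.trans_le hz.1, hz.2⟩ ν).1 hν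
    have h2 : ε * (c * Real.exp |ν i|) ≤ z * tiltSum D ν :=
      mul_le_mul hz.1 (hcb ν i) (by positivity) (hε.le.trans hz.1)
    have h3 := Real.add_one_le_exp |ν i|
    rw [Set.mem_ofPred_eq, ← one_div, le_div_iff₀ (by positivity)]
    have h4 : |ν i| * (ε * c) ≤ Real.exp |ν i| * (ε * c) :=
      mul_le_mul_of_nonneg_right (by linarith) (by positivity)
    linarith
  exact closure_minimal hsub
    (isClosed_le (continuous_apply i).abs continuous_const) hμ

lemma SuperExpDecay.assumptionOmega_rwG (hd : 1 ≤ d) {D : (Fin d → ℤ) → ℝ}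
    (h : SuperExpDecay D) (hD : ∀ x, 0 ≤ D x) (hsym : ZdSymmetric D) (hs : Summable D)
    (h1 : ∑' x, D x = 1)
    (hsupp : ∀ L : AddSubgroup (Fin d → ℤ), (∀ x, D x ≠ 0 → x ∈ L) → L = ⊤)
    {z : ℝ} (hz : z ∈ Set.Ioo (0 : ℝ) 1) : AssumptionOmega (rwG D z) where
  nonneg x := tsum_nonneg fun n =>
    mul_nonneg (pow_nonneg hz.1.le n) (convPow_mem_Icc hD hs h1 n x).1
  symm := hsym.rwG z
  open_Omega := by
    have : Omega (rwG D z) = {μ | z * tiltSum D μ < 1} :=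
      Set.ext fun μ => h.mem_Omega_rwG hD hs h1 hz μ
    rw [this]
    exact isOpen_lt (continuous_const.mul (h.continuous_tiltSum hD)) continuous_const
  zero_mem := by
    rw [h.mem_Omega_rwG hD hs h1 hz]
    simpa [tiltSum, rdotZ_zero_left, h1] using hz.2
  exists_not_mem := by
    obtain ⟨R, hR, hb⟩ := h.exists_abs_le_of_mem_closure hd hD hsym hs h1 hsupp hz.1
    refine ⟨R + 1, by positivity, fun hmem => ?_⟩
    have := hb z ⟨le_rfl, hz.2⟩ _ (subset_closure hmem) ⟨0, hd⟩
    simp only [e1R, if_true] at this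
    rw [abs_of_pos (by positivity)] at this
    linarith

theorem statement14 (d : ℕ) (hd : 1 ≤ d) (D : (Fin d → ℤ) → ℝ)
    (hD01 : ∀ x, 0 ≤ D x ∧ D x ≤ 1) (hDsym : ZdSymmetric D)
    (hDsummable : Summable D) (hDprob : ∑' x, D x = 1)
    (hDsupp : ∀ L : AddSubgroup (Fin d → ℤ), (∀ x, D x ≠ 0 → x ∈ L) → L = ⊤)
    (hDsuper : ∀ a : ℝ, 0 < a →
      Tendsto (fun x : Fin d → ℤ => D x * Real.exp (a * enormZ x)) cofinite (𝓝 0)) :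
    (∀ z ∈ Set.Ioo (0 : ℝ) 1,
      AssumptionOmega (rwG D z) ∧
      ∃ M K ζ : ℝ, AssumptionJ (rwG D z) (fun x => z * D x) (deltaZ d) M K ζ) ∧
    (∀ ε ∈ Set.Ioo (0 : ℝ) 1, ∀ ζ : ℝ, 0 < ζ → ∃ M K : ℝ, 0 < M ∧ 0 < K ∧
      ∀ z ∈ Set.Ico ε (1 : ℝ), ∀ μ ∈ closure (Omega (rwG D z)),
        MemQ M K ζ (tilt (fun x => z * D x) μ) (deltaZ d)) := by
  have hD : ∀ x, 0 ≤ D x := fun x => (hD01 x).1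
  have hdec : SuperExpDecay D := hDsuper
  have huniform : ∀ ε ∈ Set.Ioo (0 : ℝ) 1, ∀ ζ : ℝ, 0 < ζ → ∃ M K : ℝ, 0 < M ∧ 0 < K ∧
      ∀ z ∈ Set.Ico ε (1 : ℝ), ∀ μ ∈ closure (Omega (rwG D z)),
        MemQ M K ζ (tilt (fun x => z * D x) μ) (deltaZ d) := by
    intro ε hε ζ hζ
    obtain ⟨R, hR, hb⟩ :=
      hdec.exists_abs_le_of_mem_closure hd hD hDsym hDsummable hDprob hDsupp hε.1
    obtain ⟨M, K, hM, hK, hQ⟩ := hdec.exists_memQ hd hD hDsym hDsummable hDsupp hε.1 hR hζ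
    exact ⟨M, K, hM, hK, fun z hz μ hμ => hQ z hz μ (hb z hz μ hμ)⟩
  refine ⟨fun z hz => ⟨hdec.assumptionOmega_rwG hd hD hDsym hDsummable hDprob hDsupp hz, ?_⟩,
    huniform⟩
  obtain ⟨M, K, hM, hK, hQ⟩ := huniform z hz 1 one_pos
  refine ⟨M, K, 1, hM, hK, one_pos, hDsym.const_mul z, zdSymmetric_deltaZ,
    (hDsummable.mul_left z).abs, ?_, rwG_ornsteinZernike hD hDsummable hDprob hz,
    fun μ hμ => ?_, fun μ _ => ?_⟩
  · exact (hasSum_ite_eq (0 : Fin d → ℤ) (1 : ℝ)).summable.abs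
  · rw [tilt_deltaZ]
    exact hQ z ⟨le_rfl, hz.2⟩ μ hμ
  · rw [tiltSum_deltaZ]
    exact one_pos

end OZpaper
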